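/- Let G be a maxnil graph whose vertex connectivity is 3, and let S = {x, y, z} be a vertex cut set of G of size 3. Let G_1, …, G_r be the connected components of G − S. Then the subgraph of G induced by S is a complete graph K_3, and for each i with 1 ≤ i ≤ r, the subgraph of G induced by V(G_i) ∪ S is maxnil. -/

import Mathlib

open SimpleGraph

/-- `H` is a minor of `G`: there is a family of nonempty, pairwise disjoint,
connected branch sets in `G`, one for each vertex of `H`, with an edge of `G`
between the branch sets of any two adjacent vertices of `H`. -/
def IsMinor {W V : Type} (H : SimpleGraph W) (G : SimpleGraph V) : Prop :=
  ∃ f : W → Set V,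
    (∀ w, (f w).Nonempty) ∧
    (∀ w, (G.induce (f w)).Connected) ∧
    (Pairwise fun w₁ w₂ => Disjoint (f w₁) (f w₂)) ∧
    ∀ ⦃w₁ w₂⦄, H.Adj w₁ w₂ → ∃ v₁ ∈ f w₁, ∃ v₂ ∈ f w₂, G.Adj v₁ v₂

/-- The result of a `∇Y`-move on the triangle `a b c` of `G`: delete the edges of
the triangle and add a new vertex (`none`) joined to `a`, `b`, `c`. -/
def triangleY {V : Type} (G : SimpleGraph V) (a b c : V) : SimpleGraph (Option V) :=
  (SimpleGraph.map Function.Embedding.some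
      (G.deleteEdges {s(a, b), s(b, c), s(a, c)})) ⊔
    SimpleGraph.fromEdgeSet {s((none : Option V), some a), s(none, some b), s(none, some c)}

/-- Membership in the Petersen family: the graphs obtained from `K₆` by
`∇Y`-moves and `Y∇`-moves (the inverse operation), up to isomorphism. -/
inductive IsPetersenFamily : ∀ {V : Type}, SimpleGraph V → Prop
  | k6 : IsPetersenFamily (⊤ : SimpleGraph (Fin 6))
  | deltaY {V : Type} {G : SimpleGraph V} {a b c : V} :
      IsPetersenFamily G → G.Adj a b → G.Adj b c → G.Adj a c →
      IsPetersenFamily (triangleY G a b c)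
  | yDelta {V : Type} {G : SimpleGraph V} {a b c : V} :
      IsPetersenFamily (triangleY G a b c) → G.Adj a b → G.Adj b c → G.Adj a c →
      IsPetersenFamily G
  | iso {V W : Type} {G : SimpleGraph V} {H : SimpleGraph W} :
      IsPetersenFamily G → G ≃g H → IsPetersenFamily H

/-- A graph is linklessly embeddable (nIL) iff it has no minor in the Petersen family. -/
def IsLinkless {V : Type} (G : SimpleGraph V) : Prop :=
  ∀ ⦃W : Type⦄ (P : SimpleGraph W), IsPetersenFamily P → ¬ IsMinor P G

/-- The graph obtained from `G` by adding the edge `ab`. -/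
def addEdge {V : Type} (G : SimpleGraph V) (a b : V) : SimpleGraph V :=
  G ⊔ SimpleGraph.fromEdgeSet {s(a, b)}

/-- A nIL graph is maxnil if adding any edge yields a graph that is not nIL. -/
def IsMaxnil {V : Type} (G : SimpleGraph V) : Prop :=
  IsLinkless G ∧ ∀ a b : V, a ≠ b → ¬ G.Adj a b → ¬ IsLinkless (addEdge G a b)

/-- `S` is a vertex cut set of the connected graph `G` if `G - S` is disconnected. -/
def IsVertexCut {V : Type} (G : SimpleGraph V) (S : Set V) : Prop :=
  G.Connected ∧ ¬ (G.induce Sᶜ).Preconnected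

/-- A vertex cut set is minimal if no proper subset of it is a vertex cut set. -/
def IsMinimalVertexCut {V : Type} (G : SimpleGraph V) (S : Set V) : Prop :=
  IsVertexCut G S ∧ ∀ S' ⊂ S, ¬ IsVertexCut G S'

/-- A set `T` of vertices of `H` (inducing a `K₄`) is strongly separating if `H - T`
has at least two connected components such that every vertex of `T` has a
neighbor in each of them. -/
def StronglySeparating {V : Type} (H : SimpleGraph V) (T : Set V) : Prop :=
  ∃ C₁ C₂ : (H.induce Tᶜ).ConnectedComponent, C₁ ≠ C₂ ∧
    ∀ v ∈ T, (∃ u ∈ C₁.supp, H.Adj v ↑u) ∧ (∃ u ∈ C₂.supp, H.Adj v ↑u)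

/-- `G` is maximal without a `K₆` minor. -/
def IsMaximalK6MinorFree {V : Type} (G : SimpleGraph V) : Prop :=
  ¬ IsMinor (⊤ : SimpleGraph (Fin 6)) G ∧
    ∀ a b : V, a ≠ b → ¬ G.Adj a b → IsMinor (⊤ : SimpleGraph (Fin 6)) (addEdge G a b)

/-- Number of vertices of the seven graphs of the Petersen family. -/
def petSizes : List ℕ := [6, 7, 8, 8, 9, 7, 10]

/-- Edge masks of the seven graphs: bit `10 * u + v` with `u < v` encodes the edge `uv`. -/
def petMasks : List ℕ :=
  [35235970478142, 35236037648504, 176093785088224, 144256063129116792, 288406710455189728,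
   72163233137487932, 865395228826484960]

/-- Certificates `(i, v, j, s)`: the `Y∇`-move at the vertex `v` of graph `i` gives graph `j`, where
vertex `k` of graph `j` corresponds to the `k`-th hexadecimal digit of `s`. -/
def yCerts : List (ℕ × ℕ × ℕ × ℕ) :=
  [(1, 6, 0, 5517840), (2, 0, 5, 124076833), (2, 6, 1, 122819632), (2, 7, 1, 106181136),
   (3, 6, 1, 119604547), (3, 7, 1, 106181136), (4, 0, 2, 324421416), (4, 1, 2, 54941735),
   (4, 3, 2, 19355718), (4, 6, 2, 2267354115), (4, 7, 2, 2252681729), (4, 8, 2, 1985229328),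
   (6, 0, 4, 9804682545), (6, 1, 4, 10056406064), (6, 2, 4, 5761499968),
   (6, 3, 4, 18630611472), (6, 4, 4, 14335705376), (6, 5, 4, 14068314145),
   (6, 6, 4, 40921813059), (6, 7, 4, 40907264033), (6, 8, 4, 40639873312),
   (6, 9, 4, 36344967696)]

/-- Certificates `(i, t, j, v, s)`: the `∇Y`-move at the triangle `t` of graph `i` gives graph `j`
with new vertex `v`. -/
def dCerts : List (ℕ × ℕ × ℕ × ℕ × ℕ) :=
  [(0, 7, 1, 6, 5517840), (0, 11, 1, 6, 5514000), (0, 19, 1, 6, 5391120),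
   (0, 35, 1, 6, 2442000), (0, 13, 1, 6, 5513520), (0, 21, 1, 6, 5390640),
   (0, 37, 1, 6, 2441520), (0, 25, 1, 6, 5379120), (0, 41, 1, 6, 2430000),
   (0, 49, 1, 6, 2184240), (0, 14, 1, 6, 5513475), (0, 22, 1, 6, 5390595),
   (0, 38, 1, 6, 2441475), (0, 26, 1, 6, 5379075), (0, 42, 1, 6, 2429955),
   (0, 50, 1, 6, 2184195), (0, 28, 1, 6, 5378115), (0, 44, 1, 6, 2428995),
   (0, 52, 1, 6, 2183235), (0, 56, 1, 6, 2164035), (1, 25, 2, 7, 106181136),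
   (1, 41, 2, 7, 105198096), (1, 49, 2, 7, 105075216), (1, 26, 2, 7, 106181121),
   (1, 42, 2, 7, 105198081), (1, 50, 2, 7, 105075201), (1, 28, 2, 7, 106180641),
   (1, 44, 2, 7, 105197601), (1, 52, 2, 7, 105074721), (1, 56, 3, 7, 106181136),
   (2, 42, 4, 8, 1985229328), (2, 50, 4, 8, 1985167888), (2, 44, 4, 8, 1985229088),
   (2, 52, 4, 8, 1985167648), (4, 52, 6, 9, 36344967696), (5, 21, 2, 0, 38090263),
   (5, 25, 2, 0, 38101783), (5, 49, 2, 0, 40190743), (5, 22, 2, 0, 38090353),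
   (5, 26, 2, 0, 38101873), (5, 50, 2, 0, 40190833), (5, 84, 2, 0, 121976353),
   (5, 88, 2, 0, 121987873), (5, 112, 2, 0, 124076833)]

theorem natBeq_eq (a b : ℕ) : Nat.beq a b = (a == b) := by
  rw [Bool.eq_iff_iff, Nat.beq_eq, beq_iff_eq]

/-- Boolean adjacency for a mask. -/
def adjB (m u v : ℕ) : Bool :=
  (m.testBit (10 * u + v) || m.testBit (10 * v + u)) && !(Nat.beq u v)

def digit (s k : ℕ) : ℕ := (s >>> (4 * k)) % 16

def petSz (i : ℕ) : ℕ := petSizes.getD i 0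

def petM (i : ℕ) : ℕ := petMasks.getD i 0

/-- The `i`-th graph of the Petersen family. -/
def pet (i : ℕ) : SimpleGraph (Fin (petSz i)) where
  Adj u v := adjB (petM i) u v = true
  symm := ⟨by
    intro u v h
    simp only [adjB, natBeq_eq, Bool.and_eq_true, Bool.or_eq_true, Bool.not_eq_true',
      beq_eq_false_iff_ne] at h ⊢
    exact ⟨h.1.symm, fun e => h.2 e.symm⟩⟩
  loopless := ⟨by
    intro u h
    simp [adjB] at h⟩

def allB (n : ℕ) (p : ℕ → Bool) : Bool := (List.range n).all p

theorem allB_iff {n : ℕ} {p : ℕ → Bool} : allB n p = true ↔ ∀ k < n, p k = true := by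
  simp [allB]

/-- Validity of a `Y∇` certificate. -/
def yValid (i v j s : ℕ) : Bool :=
  Nat.beq (petSz j + 1) (petSz i) && allB (petSz j) fun a =>
    Nat.blt (digit s a) (petSz i) && !(Nat.beq (digit s a) v) && allB (petSz j) fun b =>
      (!(Nat.beq (digit s a) (digit s b)) || Nat.beq a b) &&
      (adjB (petM j) a b == (adjB (petM i) (digit s a) (digit s b) ||
        (!(Nat.beq a b) && adjB (petM i) v (digit s a) && adjB (petM i) v (digit s b))))

/-- Validity of a `∇Y` certificate. -/
def dValid (i t j v s : ℕ) : Bool :=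
  Nat.beq (petSz i + 1) (petSz j) && Nat.blt v (petSz j) && allB (petSz i) fun a =>
    Nat.blt (digit s a) (petSz j) && !(Nat.beq (digit s a) v) &&
    (adjB (petM j) v (digit s a) == t.testBit a) && allB (petSz i) fun b =>
      (!(Nat.beq (digit s a) (digit s b)) || Nat.beq a b) &&
      (adjB (petM j) (digit s a) (digit s b) ==
        (adjB (petM i) a b && !(t.testBit a && t.testBit b)))

def yAllCheck : Bool :=
  yCerts.all fun c => yValid c.1 c.2.1 c.2.2.1 c.2.2.2 && Nat.blt c.2.2.1 7

def dAllCheck : Bool :=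
  dCerts.all fun c => dValid c.1 c.2.1 c.2.2.1 c.2.2.2.1 c.2.2.2.2 && Nat.blt c.2.2.1 7

def hasY (i v : ℕ) : Bool := yCerts.any fun c => Nat.beq c.1 i && Nat.beq c.2.1 v

def hasD (i t : ℕ) : Bool := dCerts.any fun c => Nat.beq c.1 i && Nat.beq c.2.1 t

/-- Every vertex of degree three has a `Y∇` certificate. -/
def yExist : Bool :=
  allB 7 fun i => allB (petSz i) fun v => hasY i v ||
    allB (petSz i) fun p => !(adjB (petM i) v p) ||
      allB (petSz i) fun q => !(adjB (petM i) v q) ||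
        allB (petSz i) fun r => !(adjB (petM i) v r) ||
          (List.range (petSz i)).any fun t => adjB (petM i) v t &&
            !(Nat.beq t p) && !(Nat.beq t q) && !(Nat.beq t r)

/-- Every triangle has a `∇Y` certificate. -/
def dExist : Bool :=
  allB 7 fun i => allB (petSz i) fun a => allB (petSz i) fun b => !(adjB (petM i) a b) ||
    allB (petSz i) fun c => !(adjB (petM i) b c) || !(adjB (petM i) a c) ||
      hasD i (2 ^ a ||| 2 ^ b ||| 2 ^ c)

def inNb (n m L t : ℕ) : Bool :=
  !(L.testBit t) && (List.range n).any fun u => L.testBit u && adjB m u t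

/-- Separations of order at most three of the seven graphs. -/
def sepCheck : Bool :=
  allB 7 fun i => allB (2 ^ petSz i) fun L =>
    Nat.ble 4 ((List.range (petSz i)).filter (inNb (petSz i) (petM i) L)).length ||
    Nat.beq L 0 ||
    allB (petSz i) (fun t => L.testBit t || inNb (petSz i) (petM i) L t) ||
    (List.range (petSz i)).any (fun v => hasY i v && (Nat.beq L (2 ^ v) ||
      allB (petSz i) (fun t => Nat.beq t v || L.testBit t || inNb (petSz i) (petM i) L t)))

theorem yAllCheck_true : yAllCheck = true := by decide +kernel
theorem dAllCheck_true : dAllCheck = true := by decide +kernel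
theorem yExist_true : yExist = true := by decide +kernel
theorem dExist_true : dExist = true := by decide +kernel
theorem sepCheck_true : sepCheck = true := by decide +kernel

theorem triangleY_adj_some {V : Type} (G : SimpleGraph V) (a b c u v : V) :
    (triangleY G a b c).Adj (some u) (some v) ↔
      G.Adj u v ∧ ¬ ((u = a ∨ u = b ∨ u = c) ∧ (v = a ∨ v = b ∨ v = c)) := by
  simp only [triangleY, SimpleGraph.sup_adj, SimpleGraph.fromEdgeSet_adj,
    SimpleGraph.map_adj, SimpleGraph.deleteEdges_adj]
  constructor
  · rintro (⟨u', v', ⟨h, hn⟩, hu, hv⟩ | ⟨h, -⟩)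
    · simp only [Function.Embedding.some_apply, Option.some.injEq] at hu hv
      subst hu hv
      refine ⟨h, ?_⟩
      have := h.ne
      simp only [Set.mem_insert_iff, Set.mem_singleton_iff, Sym2.eq_iff] at hn
      grind
    · simp at h
  · rintro ⟨h, hn⟩
    refine Or.inl ⟨u, v, ⟨h, ?_⟩, rfl, rfl⟩
    simp only [Set.mem_insert_iff, Set.mem_singleton_iff, Sym2.eq_iff]
    grind

theorem triangleY_adj_none {V : Type} (G : SimpleGraph V) (a b c u : V) :
    (triangleY G a b c).Adj none (some u) ↔ (u = a ∨ u = b ∨ u = c) := by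
  simp only [triangleY, SimpleGraph.sup_adj, SimpleGraph.fromEdgeSet_adj,
    SimpleGraph.map_adj, SimpleGraph.deleteEdges_adj]
  constructor
  · rintro (⟨u', v', ⟨h, hn⟩, hu, hv⟩ | ⟨h, -⟩)
    · simp at hu
    · simpa using h
  · intro h
    right
    simpa using h

/-- Recognizing the result of a `∇Y`-move. -/
theorem iso_of_dY {α β : Type} [Finite β] {G : SimpleGraph α} {H : SimpleGraph β}
    {a b c : α} {v : β} {τ : α → β} (hinj : Function.Injective τ) (hv : ∀ s, τ s ≠ v)
    (hcard : Nat.card α + 1 = Nat.card β)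
    (hadj : ∀ s t, H.Adj (τ s) (τ t) ↔
      G.Adj s t ∧ ¬ ((s = a ∨ s = b ∨ s = c) ∧ (t = a ∨ t = b ∨ t = c)))
    (hvadj : ∀ s, H.Adj v (τ s) ↔ (s = a ∨ s = b ∨ s = c)) :
    Nonempty (triangleY G a b c ≃g H) := by
  have : Finite α := Finite.of_injective τ hinj
  let e : Option α → β := fun o => o.elim v τ
  have einj : Function.Injective e := by
    rintro (_ | s) (_ | t) h
    · rfl
    · exact absurd h.symm (hv t)
    · exact absurd h (hv s)
    · exact congrArg some (hinj h)
  have ebij : Function.Bijective e := by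
    have := Fintype.ofFinite α
    have := Fintype.ofFinite β
    rw [Fintype.bijective_iff_injective_and_card]
    refine ⟨einj, ?_⟩
    rw [Fintype.card_option, ← hcard.trans (Nat.card_eq_fintype_card), Nat.card_eq_fintype_card]
  refine ⟨⟨Equiv.ofBijective e ebij, ?_⟩⟩
  rintro (_ | s) (_ | t)
  · simp
  · simp only [Equiv.ofBijective_apply, triangleY_adj_none]
    exact hvadj t
  · simp only [Equiv.ofBijective_apply]
    rw [H.adj_comm, (triangleY G a b c).adj_comm, triangleY_adj_none]
    exact hvadj s
  · simp only [Equiv.ofBijective_apply, triangleY_adj_some]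
    exact hadj s t

/-- Recognizing the result of a `Y∇`-move. -/
theorem iso_of_yD {α β γ : Type} [Finite β] {G : SimpleGraph α} {H : SimpleGraph β}
    {K : SimpleGraph γ} {a b c : α} (hab : G.Adj a b) (hbc : G.Adj b c) (hac : G.Adj a c)
    (φ : triangleY G a b c ≃g H) {σ : γ → β} (hinj : Function.Injective σ)
    (hv : ∀ s, σ s ≠ φ none) (hcard : Nat.card γ + 1 = Nat.card β)
    (hadj : ∀ s t, K.Adj s t ↔ H.Adj (σ s) (σ t) ∨
      (s ≠ t ∧ H.Adj (φ none) (σ s) ∧ H.Adj (φ none) (σ t))) :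
    Nonempty (G ≃g K) := by
  have hex : ∀ s, ∃ u, φ (some u) = σ s := by
    intro s
    rcases h : φ.symm (σ s) with _ | u
    · exact absurd (by rw [← h]; simp) (hv s)
    · exact ⟨u, by rw [← h]; simp⟩
  choose e he using hex
  have einj : Function.Injective e := by
    intro s t h
    apply hinj
    rw [← he s, ← he t, h]
  have : Finite (Option α) := Finite.of_equiv _ φ.symm.toEquiv
  have : Finite α := Finite.of_injective (some : α → Option α) (Option.some_injective _)
  have : Finite γ := Finite.of_injective σ hinj
  have ebij : Function.Bijective e := by
    have := Fintype.ofFinite α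
    have := Fintype.ofFinite γ
    rw [Fintype.bijective_iff_injective_and_card]
    refine ⟨einj, ?_⟩
    have h1 : Nat.card (Option α) = Nat.card β := Nat.card_congr φ.toEquiv
    rw [Nat.card_eq_fintype_card, Fintype.card_option] at h1
    rw [Nat.card_eq_fintype_card] at hcard
    omega
  refine ⟨RelIso.symm ⟨Equiv.ofBijective e ebij, ?_⟩⟩
  intro s t
  simp only [Equiv.ofBijective_apply]
  rw [hadj, ← he s, ← he t, φ.map_adj_iff, φ.map_adj_iff, φ.map_adj_iff, triangleY_adj_some,
    triangleY_adj_none, triangleY_adj_none]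
  have h1 : s ≠ t ↔ e s ≠ e t := einj.ne_iff.symm
  rw [h1]
  constructor
  · intro h
    have := h.ne
    tauto
  · rintro (h | ⟨h, h2, h3⟩)
    · exact h.1
    · have := hab.symm
      have := hbc.symm
      have := hac.symm
      rcases h2 with h2 | h2 | h2 <;> rcases h3 with h3 | h3 | h3 <;> rw [h2, h3] at h ⊢ <;>
        first | assumption | exact absurd rfl h

theorem yValid_spec {i v j s : ℕ} (h : yValid i v j s = true) :
    petSz j + 1 = petSz i ∧ ∃ σ : Fin (petSz j) → Fin (petSz i), Function.Injective σ ∧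
      (∀ a, (σ a : ℕ) ≠ v) ∧ ∀ a b, (pet j).Adj a b ↔ (pet i).Adj (σ a) (σ b) ∨
        (a ≠ b ∧ adjB (petM i) v (σ a) = true ∧ adjB (petM i) v (σ b) = true) := by
  have eb : ∀ a b : ℕ, Nat.beq a b = (a == b) := natBeq_eq
  simp only [yValid, Bool.and_eq_true, allB_iff, eb, beq_iff_eq, Nat.blt_eq, Bool.not_eq_true',
    beq_eq_false_iff_ne, Bool.or_eq_true] at h
  obtain ⟨h1, h2⟩ := h
  refine ⟨h1, fun a => ⟨digit s a, (h2 a a.2).1.1⟩, ?_, fun a => (h2 a a.2).1.2, ?_⟩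
  · intro a b hab
    have := ((h2 a a.2).2 b b.2).1
    simp only [Fin.mk.injEq] at hab
    exact Fin.ext (this.resolve_left fun hn => hn hab)
  · intro a b
    have := ((h2 a a.2).2 b b.2).2
    simp only [pet]
    rw [this]
    simp only [Bool.or_eq_true, Bool.and_eq_true, Bool.not_eq_true', beq_eq_false_iff_ne,
      and_assoc, ne_eq, Fin.ext_iff]

theorem dValid_spec {i t j v s : ℕ} (h : dValid i t j v s = true) :
    petSz i + 1 = petSz j ∧ ∃ (v' : Fin (petSz j)) (τ : Fin (petSz i) → Fin (petSz j)),
      Function.Injective τ ∧ (∀ a, τ a ≠ v') ∧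
      (∀ a b, (pet j).Adj (τ a) (τ b) ↔ (pet i).Adj a b ∧
        ¬ (t.testBit a = true ∧ t.testBit b = true)) ∧
      ∀ a : Fin (petSz i), (pet j).Adj v' (τ a) ↔ t.testBit a = true := by
  have eb : ∀ a b : ℕ, Nat.beq a b = (a == b) := natBeq_eq
  simp only [dValid, Bool.and_eq_true, allB_iff, eb, beq_iff_eq, Nat.blt_eq, Bool.not_eq_true',
    beq_eq_false_iff_ne, Bool.or_eq_true] at h
  obtain ⟨⟨h1, hv⟩, h2⟩ := h
  refine ⟨h1, ⟨v, hv⟩, fun a => ⟨digit s a, (h2 a a.2).1.1.1⟩, ?_, ?_, ?_, ?_⟩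
  · intro a b hab
    have := ((h2 a a.2).2 b b.2).1
    simp only [Fin.mk.injEq] at hab
    exact Fin.ext (this.resolve_left fun hn => hn hab)
  · intro a ha
    simp only [Fin.mk.injEq] at ha
    exact (h2 a a.2).1.1.2 ha
  · intro a b
    have := ((h2 a a.2).2 b b.2).2
    simp only [pet]
    rw [this]
    simp only [Bool.and_eq_true, Bool.not_eq_true', Bool.and_eq_false_iff]
    grind
  · intro a
    have := (h2 a a.2).1.2
    simp only [pet]
    rw [this]

theorem hasY_spec {i v : ℕ} (h : hasY i v = true) :
    ∃ j < 7, petSz j + 1 = petSz i ∧ ∃ σ : Fin (petSz j) → Fin (petSz i), Function.Injective σ ∧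
      (∀ a, (σ a : ℕ) ≠ v) ∧ ∀ a b, (pet j).Adj a b ↔ (pet i).Adj (σ a) (σ b) ∨
        (a ≠ b ∧ adjB (petM i) v (σ a) = true ∧ adjB (petM i) v (σ b) = true) := by
  simp only [hasY, List.any_eq_true] at h
  obtain ⟨⟨i', v', j, s⟩, hm, hc⟩ := h
  have eb : ∀ a b : ℕ, Nat.beq a b = (a == b) := natBeq_eq
  simp only [eb, Bool.and_eq_true, beq_iff_eq] at hc
  obtain ⟨rfl, rfl⟩ := hc
  have h0 := yAllCheck_true
  simp only [yAllCheck, List.all_eq_true] at h0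
  have h1 := h0 _ hm
  simp only [Bool.and_eq_true, Nat.blt_eq] at h1
  exact ⟨j, h1.2, yValid_spec h1.1⟩

theorem testBit_tri (a b c k : ℕ) : (2 ^ a ||| 2 ^ b ||| 2 ^ c).testBit k = true ↔
    (k = a ∨ k = b ∨ k = c) := by
  simp only [Nat.testBit_or, Bool.or_eq_true, Nat.testBit_two_pow, decide_eq_true_eq]
  grind

/-- Applying a `∇Y`-move to (a graph isomorphic to) one of the seven graphs. -/
theorem hasD_iso {i t : ℕ} (h : hasD i t = true) :
    ∃ j < 7, ∀ {V : Type} (G : SimpleGraph V) (φ : G ≃g pet i) (a b c : V),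
      t = 2 ^ (φ a : ℕ) ||| 2 ^ (φ b : ℕ) ||| 2 ^ (φ c : ℕ) →
      Nonempty (triangleY G a b c ≃g pet j) := by
  simp only [hasD, List.any_eq_true] at h
  obtain ⟨⟨i', t', j, v, s⟩, hm, hc⟩ := h
  have eb : ∀ a b : ℕ, Nat.beq a b = (a == b) := natBeq_eq
  simp only [eb, Bool.and_eq_true, beq_iff_eq] at hc
  obtain ⟨rfl, rfl⟩ := hc
  have h0 := dAllCheck_true
  simp only [dAllCheck, List.all_eq_true] at h0
  have h1 := h0 _ hm
  simp only [Bool.and_eq_true, Nat.blt_eq] at h1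
  refine ⟨j, h1.2, ?_⟩
  obtain ⟨hsz, v', τ, hinj, hv, hadj, hvadj⟩ := dValid_spec h1.1
  intro V G φ a b c ht
  have key : ∀ u : V, t'.testBit (φ u : ℕ) = true ↔ (u = a ∨ u = b ∨ u = c) := by
    intro u
    rw [ht, testBit_tri]
    simp only [← Fin.ext_iff, φ.injective.eq_iff]
  refine iso_of_dY (τ := fun u => τ (φ u)) (v := v') (hinj.comp φ.injective) (fun s => hv _)
    ?_ ?_ ?_
  · rw [Nat.card_congr φ.toEquiv]
    simpa using hsz
  · intro s t
    rw [hadj, φ.map_adj_iff, key, key]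
  · intro s
    rw [hvadj, key]

theorem petersen_classify {V : Type} {P : SimpleGraph V} (h : IsPetersenFamily P) :
    ∃ i < 7, Nonempty (P ≃g pet i) := by
  induction h with
  | k6 =>
    refine ⟨0, by norm_num, ⟨⟨Equiv.refl (Fin 6), ?_⟩⟩⟩
    have : ∀ a b : Fin 6, adjB (petM 0) a b = true ↔ a ≠ b := by decide +kernel
    intro a b
    exact this a b
  | @deltaY V G a b c _ hab hbc hac ih =>
    obtain ⟨i, hi, ⟨φ⟩⟩ := ih
    have h0 := dExist_true
    simp only [dExist, allB_iff, Bool.or_eq_true, Bool.not_eq_true'] at h0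
    have e1 : adjB (petM i) (φ a) (φ b) = true := φ.map_adj_iff.2 hab
    have e2 : adjB (petM i) (φ b) (φ c) = true := φ.map_adj_iff.2 hbc
    have e3 : adjB (petM i) (φ a) (φ c) = true := φ.map_adj_iff.2 hac
    have h1 := h0 i hi (φ a) (φ a).2 (φ b) (φ b).2
    rw [e1] at h1
    have h2 := (h1.resolve_left (by simp)) (φ c) (φ c).2
    rw [e2, e3] at h2
    have h3 : hasD i (2 ^ (φ a : ℕ) ||| 2 ^ (φ b : ℕ) ||| 2 ^ (φ c : ℕ)) = true := by
      simpa using h2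
    obtain ⟨j, hj, hiso⟩ := hasD_iso h3
    exact ⟨j, hj, hiso G φ a b c rfl⟩
  | @yDelta V G a b c _ hab hbc hac ih =>
    obtain ⟨i, hi, ⟨φ⟩⟩ := ih
    have h0 := yExist_true
    have eb : ∀ a b : ℕ, Nat.beq a b = (a == b) := natBeq_eq
    simp only [yExist, allB_iff, Bool.or_eq_true, Bool.not_eq_true', List.any_eq_true, eb,
      Bool.and_eq_true, beq_eq_false_iff_ne, List.mem_range] at h0
    have hn : ∀ u, adjB (petM i) (φ none) (φ (some u)) = true ↔ (u = a ∨ u = b ∨ u = c) := by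
      intro u
      rw [← triangleY_adj_none G a b c u]
      exact φ.map_adj_iff
    have hY : hasY i (φ none) = true := by
      rcases h0 i hi (φ none) (φ none).2 with h1 | h1
      · exact h1
      exfalso
      have h2 := (h1 (φ (some a)) (φ (some a)).2).resolve_left
        (by rw [(hn a).2 (by simp)]; simp)
      have h3 := (h2 (φ (some b)) (φ (some b)).2).resolve_left
        (by rw [(hn b).2 (by simp)]; simp)
      have h4 := (h3 (φ (some c)) (φ (some c)).2).resolve_left
        (by rw [(hn c).2 (by simp)]; simp)
      obtain ⟨t, ht, ⟨⟨ht1, ht2⟩, ht3⟩, ht4⟩ := h4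
      obtain ⟨o, ho⟩ := φ.surjective ⟨t, ht⟩
      have ho' : t = (φ o : ℕ) := by rw [ho]
      subst ho'
      rcases o with _ | u
      · simp [adjB] at ht1
      · rcases (hn u).1 ht1 with hu | hu | hu
        · exact ht2 (by rw [hu])
        · exact ht3 (by rw [hu])
        · exact ht4 (by rw [hu])
    obtain ⟨j, hj, hsz, σ, hinj, hv, hadj⟩ := hasY_spec hY
    refine ⟨j, hj, iso_of_yD hab hbc hac φ hinj (fun s hs => hv s (by rw [hs])) ?_ hadj⟩
    simpa using hsz
  | iso _ e ih =>
    obtain ⟨i, hi, ⟨φ⟩⟩ := ih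
    exact ⟨i, hi, ⟨e.symm.trans φ⟩⟩

theorem pet_step {i j : ℕ} (t : ℕ) (a b c : Fin (petSz i))
    (ht : t = 2 ^ (a : ℕ) ||| 2 ^ (b : ℕ) ||| 2 ^ (c : ℕ))
    {v s : ℕ} (h : dValid i t j v s = true) : Nonempty (triangleY (pet i) a b c ≃g pet j) := by
  obtain ⟨hsz, v', τ, hinj, hv, hadj, hvadj⟩ := dValid_spec h
  have key : ∀ u : Fin (petSz i), t.testBit (u : ℕ) = true ↔ (u = a ∨ u = b ∨ u = c) := by
    intro u
    rw [ht, testBit_tri]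
    simp only [← Fin.ext_iff]
  refine iso_of_dY (τ := τ) (v := v') hinj hv (by simpa using hsz) ?_ ?_
  · intro s t
    rw [hadj, key, key]
  · intro s
    rw [hvadj, key]

/-- One `∇Y`-step or `Y∇`-step between two of the seven graphs. -/
theorem pet_step_fam {i j : ℕ} (t a b c v s : ℕ)
    (hc : (Nat.blt a (petSz i) && Nat.blt b (petSz i) && Nat.blt c (petSz i) &&
      adjB (petM i) a b && adjB (petM i) b c && adjB (petM i) a c &&
      Nat.beq t (2 ^ a ||| 2 ^ b ||| 2 ^ c) && dValid i t j v s) = true) :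
    IsPetersenFamily (pet i) ↔ IsPetersenFamily (pet j) := by
  have eb : ∀ a b : ℕ, Nat.beq a b = (a == b) := natBeq_eq
  simp only [Bool.and_eq_true, Nat.blt_eq, eb, beq_iff_eq] at hc
  obtain ⟨⟨⟨⟨⟨⟨⟨ha, hb⟩, hc⟩, hab⟩, hbc⟩, hac⟩, ht⟩, hd⟩ := hc
  obtain ⟨φ⟩ := pet_step (i := i) (j := j) t ⟨a, ha⟩ ⟨b, hb⟩ ⟨c, hc⟩ ht hd
  have hab' : (pet i).Adj ⟨a, ha⟩ ⟨b, hb⟩ := hab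
  have hbc' : (pet i).Adj ⟨b, hb⟩ ⟨c, hc⟩ := hbc
  have hac' : (pet i).Adj ⟨a, ha⟩ ⟨c, hc⟩ := hac
  constructor
  · intro h
    exact (h.deltaY hab' hbc' hac').iso φ
  · intro h
    exact (h.iso φ.symm).yDelta hab' hbc' hac'

theorem pet_fam {i : ℕ} (hi : i < 7) : IsPetersenFamily (pet i) := by
  have h0 : IsPetersenFamily (pet 0) := by
    have : ∀ a b : Fin 6, adjB (petM 0) a b = true ↔ a ≠ b := by decide +kernel
    exact IsPetersenFamily.k6.iso (⟨Equiv.refl (Fin 6), fun {a b} => this a b⟩)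
  have h1 := (pet_step_fam (i := 0) (j := 1) 7 0 1 2 6 5517840 (by decide +kernel)).1 h0
  have h2 := (pet_step_fam (i := 1) (j := 2) 25 0 3 4 7 106181136 (by decide +kernel)).1 h1
  have h3 := (pet_step_fam (i := 1) (j := 3) 56 3 4 5 7 106181136 (by decide +kernel)).1 h1
  have h4 := (pet_step_fam (i := 2) (j := 4) 42 1 3 5 8 1985229328 (by decide +kernel)).1 h2
  have h5 := (pet_step_fam (i := 5) (j := 2) 21 0 2 4 0 38090263 (by decide +kernel)).2 h2
  have h6 := (pet_step_fam (i := 4) (j := 6) 52 2 4 5 9 36344967696 (by decide +kernel)).1 h4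
  interval_cases i <;> assumption

/-- Every separation of order at most three of `P` can be reduced to one side. -/
def SepRed {W : Type} (P : SimpleGraph W) (X R : Set W) : Prop :=
  ∃ (W' : Type) (P' : SimpleGraph W') (ψ : W' → W), IsPetersenFamily P' ∧
    Function.Injective ψ ∧ (∀ u, ψ u ∉ R) ∧
    ∀ u₁ u₂, P'.Adj u₁ u₂ → P.Adj (ψ u₁) (ψ u₂) ∨ (ψ u₁ ∈ X ∧ ψ u₂ ∈ X)

theorem sepRed_of_hasY {i : ℕ} {X R : Set (Fin (petSz i))} {v : Fin (petSz i)}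
    (hv : hasY i v = true) (hR : ∀ u ∈ R, u = v) (hX : ∀ u, (pet i).Adj v u → u ∈ X) :
    SepRed (pet i) X R := by
  obtain ⟨j, hj, hsz, σ, hinj, hv, hadj⟩ := hasY_spec hv
  refine ⟨_, pet j, σ, pet_fam hj, hinj, ?_, ?_⟩
  · intro u hu
    exact hv u (by rw [hR _ hu])
  · intro u₁ u₂ h
    rcases (hadj u₁ u₂).1 h with h | ⟨-, h1, h2⟩
    · exact Or.inl h
    · exact Or.inr ⟨hX _ h1, hX _ h2⟩

theorem sepRed_pet {i : ℕ} (hi : i < 7) (X L R : Set (Fin (petSz i))) (hX : X.encard ≤ 3)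
    (hcov : ∀ w, w ∈ X ∨ w ∈ L ∨ w ∈ R) (hRX : Disjoint R X)
    (hLR : Disjoint L R)
    (hno : ∀ u ∈ L, ∀ v ∈ R, ¬ (pet i).Adj u v) :
    SepRed (pet i) X R ∨ SepRed (pet i) X L := by
  classical
  rw [Set.disjoint_left] at hRX hLR
  have hid : ∀ T : Set (Fin (petSz i)), (∀ u, u ∉ T) → SepRed (pet i) X T := fun T hT =>
    ⟨_, pet i, id, pet_fam hi, Function.injective_id, fun u => hT u, fun _ _ h => Or.inl h⟩
  let l : ℕ := Nat.ofBits (n := petSz i) (fun k => decide (k ∈ L))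
  have hl : l < 2 ^ petSz i := Nat.ofBits_lt_two_pow _
  have hbit : ∀ k : Fin (petSz i), l.testBit k = true ↔ k ∈ L := by
    intro k
    simp [l, Nat.testBit_ofBits_lt _ _ k.2]
  have hnb : ∀ k : Fin (petSz i), inNb (petSz i) (petM i) l k = true → k ∈ X := by
    intro k hk
    simp only [inNb, Bool.and_eq_true, Bool.not_eq_true', List.any_eq_true, List.mem_range] at hk
    obtain ⟨h1, u, hu, h2, h3⟩ := hk
    have h4 : (⟨u, hu⟩ : Fin (petSz i)) ∈ L := (hbit ⟨u, hu⟩).1 h2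
    have h5 : k ∉ L := by
      rw [← hbit, h1]
      simp
    rcases hcov k with h | h | h
    · exact h
    · exact absurd h h5
    · exact absurd h3 (hno _ h4 _ h)
  have eb : ∀ a b : ℕ, Nat.beq a b = (a == b) := natBeq_eq
  have h0 := sepCheck_true
  simp only [sepCheck, allB_iff] at h0
  have h1 := h0 i hi l hl
  simp only [Bool.or_eq_true, Bool.and_eq_true, List.any_eq_true, List.mem_range, eb, beq_iff_eq,
    allB_iff, Nat.ble_eq] at h1
  rcases h1 with ((h1 | h1) | h1) | ⟨v, hv, hY, h1 | h1⟩
  · exfalso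
    have hnd : ((List.range (petSz i)).filter (inNb (petSz i) (petM i) l)).Nodup :=
      List.nodup_range.filter _
    rw [← List.toFinset_card_of_nodup hnd] at h1
    have hsub : ((((List.range (petSz i)).filter (inNb (petSz i) (petM i) l)).toFinset : Finset ℕ)
        : Set ℕ) ⊆ Fin.val '' X := by
      intro k hk
      simp only [List.coe_toFinset, Set.mem_ofPred_eq, List.mem_filter, List.mem_range] at hk
      exact ⟨⟨k, hk.1⟩, hnb ⟨k, hk.1⟩ hk.2, rfl⟩
    have h2 := (Set.encard_le_encard hsub).trans ((Set.encard_image_le _ _).trans hX)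
    rw [Set.encard_coe_eq_coe_finsetCard] at h2
    have h3 : (4 : ℕ∞) ≤ 3 := le_trans (by exact_mod_cast h1) h2
    exact absurd h3 (by decide)
  · right
    apply hid
    intro u hu
    rw [← hbit, h1] at hu
    simp at hu
  · left
    apply hid
    intro u hu
    rcases h1 u u.2 with h | h
    · exact hLR ((hbit u).1 h) hu
    · exact hRX hu (hnb u h)
  · right
    have hLv : ∀ u, u ∈ L ↔ u = ⟨v, hv⟩ := by
      intro u
      rw [← hbit, h1, Nat.testBit_two_pow, decide_eq_true_eq, Fin.ext_iff, eq_comm]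
    refine sepRed_of_hasY (v := ⟨v, hv⟩) hY (fun u hu => (hLv u).1 hu) ?_
    intro u hu
    rcases hcov u with h | h | h
    · exact h
    · rw [(hLv u).1 h] at hu
      exact absurd hu ((pet i).loopless.irrefl _)
    · exact absurd hu (hno _ ((hLv _).2 rfl) _ h)
  · left
    have hRv : ∀ u ∈ R, u = ⟨v, hv⟩ := by
      intro u hu
      rcases h1 u u.2 with (h | h) | h
      · exact Fin.ext h
      · exact absurd hu (hLR ((hbit u).1 h))
      · exact absurd (hnb u h) (hRX hu)
    by_cases hvR : (⟨v, hv⟩ : Fin (petSz i)) ∈ R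
    · refine sepRed_of_hasY (v := ⟨v, hv⟩) hY hRv ?_
      intro u hu
      rcases hcov u with h | h | h
      · exact h
      · exact absurd hu.symm (hno _ h _ hvR)
      · rw [hRv u h] at hu
        exact absurd hu ((pet i).loopless.irrefl _)
    · apply hid
      intro u hu
      have := hRv u hu
      subst this
      exact hvR hu

theorem sepRed_fam {W : Type} {P : SimpleGraph W} (hP : IsPetersenFamily P) (X L R : Set W)
    (hX : X.encard ≤ 3)
    (hcov : ∀ w, w ∈ X ∨ w ∈ L ∨ w ∈ R) (hRX : Disjoint R X)
    (hLR : Disjoint L R)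
    (hno : ∀ u ∈ L, ∀ v ∈ R, ¬ P.Adj u v) :
    SepRed P X R ∨ SepRed P X L := by
  obtain ⟨i, hi, ⟨φ⟩⟩ := petersen_classify hP
  have trans : ∀ T, SepRed (pet i) (φ.symm ⁻¹' X) (φ.symm ⁻¹' T) → SepRed P X T := by
    rintro T ⟨W', P', ψ, h1, h2, h3, h4⟩
    refine ⟨W', P', φ.symm ∘ ψ, h1, φ.symm.injective.comp h2, h3, ?_⟩
    intro u₁ u₂ h
    rcases h4 u₁ u₂ h with h | h
    · exact Or.inl (φ.symm.map_adj_iff.2 h)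
    · exact Or.inr h
  have := sepRed_pet hi (φ.symm ⁻¹' X) (φ.symm ⁻¹' L) (φ.symm ⁻¹' R) ?_ (fun w => hcov _)
    (hRX.preimage _) (hLR.preimage _)
    (fun u hu v hv h => hno _ hu _ hv (φ.symm.map_adj_iff.2 h))
  · exact this.imp (trans R) (trans L)
  · refine le_trans ?_ hX
    exact (Set.encard_preimage_of_bijective φ.symm.bijective X).le

/-- Connectedness of a vertex set, phrased through closed subsets. -/
def ConnSet {V : Type} (G : SimpleGraph V) (s : Set V) : Prop :=
  ∀ T : Set V, (∀ u ∈ s, ∀ v ∈ s, G.Adj u v → u ∈ T → v ∈ T) → ∀ u ∈ s, ∀ v ∈ s, u ∈ T → v ∈ T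

theorem preconnected_iff_connSet {V : Type} (G : SimpleGraph V) (s : Set V) :
    (G.induce s).Preconnected ↔ ConnSet G s := by
  constructor
  · intro h T hT u hu v hv huT
    obtain ⟨p⟩ := h ⟨u, hu⟩ ⟨v, hv⟩
    have key : ∀ {a b : s} (_ : (G.induce s).Walk a b), (a : V) ∈ T → (b : V) ∈ T := by
      intro a b p
      induction p with
      | nil => exact id
      | @cons a b c hab _ ih => exact fun ha => ih (hT a a.2 b b.2 hab ha)
    exact key p huT
  · intro h u v
    have := h {w | ∃ hw : w ∈ s, (G.induce s).Reachable u ⟨w, hw⟩} ?_ u u.2 v v.2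
      ⟨u.2, SimpleGraph.Reachable.refl _⟩
    · obtain ⟨_, hr⟩ := this
      exact hr
    · rintro a ha b hb hab ⟨_, hr⟩
      refine ⟨hb, hr.trans (SimpleGraph.Adj.reachable ?_)⟩
      exact hab

theorem connected_iff_connSet {V : Type} (G : SimpleGraph V) (s : Set V) :
    (G.induce s).Connected ↔ s.Nonempty ∧ ConnSet G s := by
  rw [SimpleGraph.connected_iff, preconnected_iff_connSet, and_comm, Set.nonempty_coe_sort]

/-- A minor model of `P` in `G` whose branch sets lie in `A`. -/
structure Model {W V : Type} (P : SimpleGraph W) (G : SimpleGraph V) (A : Set V)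
    (f : W → Set V) : Prop where
  sub : ∀ w, f w ⊆ A
  ne : ∀ w, (f w).Nonempty
  conn : ∀ w, ConnSet G (f w)
  disj : ∀ w₁ w₂ v, v ∈ f w₁ → v ∈ f w₂ → w₁ = w₂
  adj : ∀ w₁ w₂, P.Adj w₁ w₂ → ∃ v₁ ∈ f w₁, ∃ v₂ ∈ f w₂, G.Adj v₁ v₂

theorem isMinor_induce_iff {W V : Type} (P : SimpleGraph W) (G : SimpleGraph V) (A : Set V) :
    IsMinor P (G.induce A) ↔ ∃ f, Model P G A f := by
  constructor
  · rintro ⟨f, hne, hc, hd, ha⟩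
    refine ⟨fun w => Subtype.val '' f w, ?_, ?_, ?_, ?_, ?_⟩
    · rintro w _ ⟨a, _, rfl⟩
      exact a.2
    · exact fun w => (hne w).image _
    · intro w T hT
      have h := ((connected_iff_connSet _ _).1 (hc w)).2 (Subtype.val ⁻¹' T)
        (fun u hu v hv huv => hT u ⟨u, hu, rfl⟩ v ⟨v, hv, rfl⟩ huv)
      rintro _ ⟨u, hu, rfl⟩ _ ⟨v, hv, rfl⟩
      exact h u hu v hv
    · rintro w₁ w₂ _ ⟨u, hu, rfl⟩ ⟨v, hv, huv⟩
      by_contra hne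
      have := Set.disjoint_left.1 (hd hne) hu
      rw [Subtype.ext huv] at hv
      exact this hv
    · intro w₁ w₂ h
      obtain ⟨u, hu, v, hv, huv⟩ := ha h
      exact ⟨u, ⟨u, hu, rfl⟩, v, ⟨v, hv, rfl⟩, huv⟩
  · rintro ⟨f, h⟩
    refine ⟨fun w => Subtype.val ⁻¹' f w, ?_, ?_, ?_, ?_⟩
    · intro w
      obtain ⟨v, hv⟩ := h.ne w
      exact ⟨⟨v, h.sub w hv⟩, hv⟩
    · intro w
      rw [connected_iff_connSet]
      constructor
      · obtain ⟨v, hv⟩ := h.ne w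
        exact ⟨⟨v, h.sub w hv⟩, hv⟩
      · intro T hT u hu v hv huT
        have := h.conn w (Subtype.val '' T) ?_ u hu v hv ⟨u, huT, rfl⟩
        · obtain ⟨v', hv', e⟩ := this
          rwa [← Subtype.ext e]
        · rintro _ ha b hb hab ⟨a, haT, rfl⟩
          exact ⟨⟨b, h.sub w hb⟩, hT a ha ⟨b, h.sub w hb⟩ hb hab haT, rfl⟩
    · intro w₁ w₂ hne
      rw [Set.disjoint_left]
      intro v h1 h2
      exact hne (h.disj _ _ _ h1 h2)
    · intro w₁ w₂ hw
      obtain ⟨u, hu, v, hv, huv⟩ := h.adj _ _ hw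
      exact ⟨⟨u, h.sub _ hu⟩, hu, ⟨v, h.sub _ hv⟩, hv, huv⟩

theorem isMinor_iff {W V : Type} (P : SimpleGraph W) (G : SimpleGraph V) :
    IsMinor P G ↔ ∃ f, Model P G Set.univ f := by
  constructor
  · rintro ⟨f, hne, hc, hd, ha⟩
    refine ⟨f, fun w => Set.subset_univ _, hne,
      fun w => ((connected_iff_connSet _ _).1 (hc w)).2, ?_, fun w₁ w₂ h => ha h⟩
    intro w₁ w₂ v h1 h2
    by_contra hne
    exact Set.disjoint_left.1 (hd hne) h1 h2
  · rintro ⟨f, h⟩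
    refine ⟨f, h.ne, fun w => (connected_iff_connSet _ _).2 ⟨h.ne w, h.conn w⟩, ?_,
      fun w₁ w₂ hw => h.adj _ _ hw⟩
    intro w₁ w₂ hne
    rw [Set.disjoint_left]
    intro v h1 h2
    exact hne (h.disj _ _ _ h1 h2)

/-- `G[A]` has a minor in the Petersen family. -/
def HasPet {V : Type} (G : SimpleGraph V) (A : Set V) : Prop :=
  ∃ (W : Type) (P : SimpleGraph W) (f : W → Set V), IsPetersenFamily P ∧ Model P G A f

theorem isLinkless_iff {V : Type} (G : SimpleGraph V) :
    IsLinkless G ↔ ¬ HasPet G Set.univ := by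
  constructor
  · rintro h ⟨W, P, f, hP, hf⟩
    exact h P hP ((isMinor_iff P G).2 ⟨f, hf⟩)
  · intro h W P hP hm
    obtain ⟨f, hf⟩ := (isMinor_iff P G).1 hm
    exact h ⟨W, P, f, hP, hf⟩

theorem isLinkless_induce_iff {V : Type} (G : SimpleGraph V) (A : Set V) :
    IsLinkless (G.induce A) ↔ ¬ HasPet G A := by
  constructor
  · rintro h ⟨W, P, f, hP, hf⟩
    exact h P hP ((isMinor_induce_iff P G A).2 ⟨f, hf⟩)
  · intro h W P hP hm
    obtain ⟨f, hf⟩ := (isMinor_induce_iff P G A).1 hm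
    exact h ⟨W, P, f, hP, hf⟩

theorem HasPet.mono {V : Type} {G H : SimpleGraph V} {A B : Set V} (h : HasPet G A) (hAB : A ⊆ B)
    (hGH : ∀ u ∈ A, ∀ v ∈ A, G.Adj u v → H.Adj u v) : HasPet H B := by
  obtain ⟨W, P, f, hP, hf⟩ := h
  refine ⟨W, P, f, hP, fun w => (hf.sub w).trans hAB, hf.ne, ?_, hf.disj, ?_⟩
  · intro w T hT
    exact hf.conn w T fun u hu v hv huv =>
      hT u hu v hv (hGH u (hf.sub w hu) v (hf.sub w hv) huv)
  · intro w₁ w₂ h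
    obtain ⟨u, hu, v, hv, huv⟩ := hf.adj _ _ h
    exact ⟨u, hu, v, hv, hGH u (hf.sub _ hu) v (hf.sub _ hv) huv⟩

/-- One side of the clique-sum argument: restrict a model to `A`. -/
theorem hasPet_side {V W : Type} {G : SimpleGraph V} {S A : Set V} {P : SimpleGraph W}
    {f : W → Set V} (hf : Model P G Set.univ f) (hSA : S ⊆ A)
    (hS : ∀ s ∈ S, ∀ t ∈ S, s ≠ t → G.Adj s t)
    (hsep : ∀ u ∈ A, u ∉ S → ∀ v, v ∉ A → ¬ G.Adj u v)
    (h : SepRed P {w | (f w ∩ S).Nonempty} {w | f w ⊆ Aᶜ}) : HasPet G A := by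
  obtain ⟨W', P', ψ, hP', hψ, hR, hadj⟩ := h
  refine ⟨W', P', fun u => f (ψ u) ∩ A, hP', fun u => Set.inter_subset_right, ?_, ?_, ?_, ?_⟩
  · intro u
    have := hR u
    simp only [Set.mem_ofPred_eq, Set.not_subset] at this
    obtain ⟨v, hv, hvA⟩ := this
    exact ⟨v, hv, by simpa using hvA⟩
  · rintro w T hT u ⟨hu, huA⟩ v ⟨hv, hvA⟩ huT
    by_contra hvT
    have hTS : ∀ s ∈ S, s ∈ f (ψ w) → ∀ t ∈ S, t ∈ f (ψ w) → s ∈ T → t ∈ T := by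
      intro s hs hsf t ht htf hsT
      by_cases hst : s = t
      · exact hst ▸ hsT
      · exact hT s ⟨hsf, hSA hs⟩ t ⟨htf, hSA ht⟩ (hS s hs t ht hst) hsT
    by_cases hm : ∃ s ∈ S, s ∈ f (ψ w) ∧ s ∈ T
    · obtain ⟨s, hs, hsf, hsT⟩ := hm
      have := hf.conn (ψ w) (T ∪ Aᶜ) ?_ u hu v hv (Or.inl huT)
      · rcases this with h | h
        · exact hvT h
        · exact h hvA
      · intro a ha b hb hab haT
        by_cases hbA : b ∈ A
        · left
          by_cases haA : a ∈ A
          · exact hT a ⟨ha, haA⟩ b ⟨hb, hbA⟩ hab (haT.resolve_right (fun h => h haA))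
          · by_cases hbS : b ∈ S
            · exact hTS s hs hsf b hbS hb hsT
            · exact absurd hab.symm (hsep b hbA hbS a haA)
        · exact Or.inr hbA
    · have := hf.conn (ψ w) (T ∩ A) ?_ u hu v hv ⟨huT, huA⟩
      · exact hvT this.1
      · rintro a ha b hb hab ⟨haT, haA⟩
        have haS : a ∉ S := fun h => hm ⟨a, h, ha, haT⟩
        have hbA : b ∈ A := by
          by_contra hbA
          exact hsep a haA haS b hbA hab
        exact ⟨hT a ⟨ha, haA⟩ b ⟨hb, hbA⟩ hab haT, hbA⟩
  · rintro w₁ w₂ v ⟨h1, -⟩ ⟨h2, -⟩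
    exact hψ (hf.disj _ _ _ h1 h2)
  · intro u₁ u₂ hu
    have key : (f (ψ u₁) ∩ S).Nonempty → (f (ψ u₂) ∩ S).Nonempty →
        ∃ v₁ ∈ f (ψ u₁) ∩ A, ∃ v₂ ∈ f (ψ u₂) ∩ A, G.Adj v₁ v₂ := by
      rintro ⟨s, hs, hsS⟩ ⟨t, ht, htS⟩
      refine ⟨s, ⟨hs, hSA hsS⟩, t, ⟨ht, hSA htS⟩, hS s hsS t htS ?_⟩
      rintro rfl
      exact hu.ne (hψ (hf.disj _ _ _ hs ht))
    rcases hadj u₁ u₂ hu with h | ⟨h1, h2⟩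
    · obtain ⟨a, ha, b, hb, hab⟩ := hf.adj _ _ h
      by_cases haA : a ∈ A
      · by_cases hbA : b ∈ A
        · exact ⟨a, ⟨ha, haA⟩, b, ⟨hb, hbA⟩, hab⟩
        · have haS : a ∈ S := by
            by_contra haS
            exact hsep a haA haS b hbA hab
          refine key ⟨a, ha, haS⟩ ?_
          -- the branch set of `u₂` meets both `A` and its complement
          by_contra hno
          have hno' : ∀ s ∈ f (ψ u₂), s ∉ S := fun s hs hsS => hno ⟨s, hs, hsS⟩
          have := hR u₂
          simp only [Set.mem_ofPred_eq, Set.not_subset] at this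
          obtain ⟨c, hc, hcA⟩ := this
          have hcA : c ∈ A := by simpa using hcA
          refine hbA (hf.conn (ψ u₂) A ?_ c hc b hb hcA)
          intro p hp q hq hpq hpA
          by_contra hqA
          exact hsep p hpA (hno' p hp) q hqA hpq
      · by_cases hbS : b ∈ S
        · refine key ?_ ⟨b, hb, hbS⟩
          by_contra hno
          have hno' : ∀ s ∈ f (ψ u₁), s ∉ S := fun s hs hsS => hno ⟨s, hs, hsS⟩
          have := hR u₁
          simp only [Set.mem_ofPred_eq, Set.not_subset] at this
          obtain ⟨c, hc, hcA⟩ := this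
          have hcA : c ∈ A := by simpa using hcA
          refine haA (hf.conn (ψ u₁) A ?_ c hc a ha hcA)
          intro p hp q hq hpq hpA
          by_contra hqA
          exact hsep p hpA (hno' p hp) q hqA hpq
        · have meets : ∀ u d, d ∈ f (ψ u) → d ∉ A → (f (ψ u) ∩ S).Nonempty := by
            intro u d hd hdA
            by_contra hno
            have hno' : ∀ s ∈ f (ψ u), s ∉ S := fun s hs hsS => hno ⟨s, hs, hsS⟩
            have := hR u
            simp only [Set.mem_ofPred_eq, Set.not_subset] at this
            obtain ⟨c, hc, hcA⟩ := this
            have hcA : c ∈ A := by simpa using hcA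
            refine hdA (hf.conn (ψ u) A ?_ c hc d hd hcA)
            intro p hp q hq hpq hpA
            by_contra hqA
            exact hsep p hpA (hno' p hp) q hqA hpq
          by_cases hbA : b ∈ A
          · exact absurd hab.symm (hsep b hbA hbS a haA)
          · exact key (meets u₁ a ha haA) (meets u₂ b hb hbA)
    · exact key h1 h2

/-- A clique sum over at most three vertices of linkless graphs is linkless. -/
theorem hasPet_cliqueSum {V : Type} {G : SimpleGraph V} {S A B : Set V} (hcard : S.encard ≤ 3)
    (hSA : S ⊆ A) (hSB : S ⊆ B) (hAB : ∀ v, v ∈ A ∨ v ∈ B) (hABS : ∀ v ∈ A, v ∈ B → v ∈ S)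
    (hS : ∀ s ∈ S, ∀ t ∈ S, s ≠ t → G.Adj s t)
    (hsep : ∀ u ∈ A, u ∉ B → ∀ v ∈ B, v ∉ A → ¬ G.Adj u v)
    (h : HasPet G Set.univ) : HasPet G A ∨ HasPet G B := by
  obtain ⟨W, P, f, hP, hf⟩ := h
  have hsA : ∀ u ∈ A, u ∉ S → ∀ v, v ∉ A → ¬ G.Adj u v := fun u hu huS v hv =>
    hsep u hu (fun h => huS (hABS u hu h)) v ((hAB v).resolve_left hv) hv
  have hsB : ∀ u ∈ B, u ∉ S → ∀ v, v ∉ B → ¬ G.Adj u v := fun u hu huS v hv huv =>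
    hsep v ((hAB v).resolve_right hv) hv u hu (fun h => huS (hABS u h hu)) huv.symm
  have := sepRed_fam hP {w | (f w ∩ S).Nonempty} {w | f w ⊆ Bᶜ} {w | f w ⊆ Aᶜ} ?_ ?_ ?_ ?_ ?_
  · exact this.imp (hasPet_side hf hSA hS hsA) (hasPet_side hf hSB hS hsB)
  · have hex : ∀ w, ∃ v, (f w ∩ S).Nonempty → v ∈ f w ∩ S := by
      intro w
      by_cases hw : (f w ∩ S).Nonempty
      · obtain ⟨v, hv⟩ := hw
        exact ⟨v, fun _ => hv⟩
      · obtain ⟨v, -⟩ := hf.ne w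
        exact ⟨v, fun h => absurd h hw⟩
    choose g hg using hex
    refine le_trans (Set.encard_le_encard_of_injOn (f := g) (t := S) ?_ ?_) hcard
    · intro w hw
      exact (hg w hw).2
    · intro w hw w' hw' e
      have h1 := (hg w hw).1
      rw [e] at h1
      exact hf.disj _ _ _ h1 (hg w' hw').1
  · intro w
    by_cases hw : (f w ∩ S).Nonempty
    · exact Or.inl hw
    right
    have hno : ∀ s ∈ f w, s ∉ S := fun s hs hsS => hw ⟨s, hs, hsS⟩
    obtain ⟨c, hc⟩ := hf.ne w
    by_cases hcA : c ∈ A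
    · left
      have : ∀ d ∈ f w, d ∈ A := fun d hd => hf.conn w A (by
        intro p hp q hq hpq hpA
        by_contra hqA
        exact hsA p hpA (hno p hp) q hqA hpq) c hc d hd hcA
      intro d hd hdB
      exact hno d hd (hABS d (this d hd) hdB)
    · right
      have : ∀ d ∈ f w, d ∈ Aᶜ := fun d hd => hf.conn w Aᶜ (by
        intro p hp q hq hpq hpA hqA
        exact hsA q hqA (hno q hq) p hpA hpq.symm) c hc d hd hcA
      exact this
  · rw [Set.disjoint_left]
    rintro w hw ⟨s, hs, hsS⟩
    exact hw hs (hSA hsS)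
  · rw [Set.disjoint_left]
    intro w h1 h2
    obtain ⟨c, hc⟩ := hf.ne w
    exact (hAB c).elim (h2 hc) (h1 hc)
  · intro u hu v hv huv
    obtain ⟨a, ha, b, hb, hab⟩ := hf.adj _ _ huv
    have haB := hu ha
    have hbA := hv hb
    exact hsep a ((hAB a).resolve_right haB) haB b ((hAB b).resolve_left hbA) hbA hab

/-- The case where all uses of triangle edges involve a single branch set `w₀`. -/
theorem hasPet_cover {V W : Type} {G G' : SimpleGraph V} {S A D : Set V} {P : SimpleGraph W}
    (hP : IsPetersenFamily P) {f : W → Set V} (hf : Model P G' A f)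
    (hGG : ∀ u v, G'.Adj u v → G.Adj u v ∨ (u ∈ S ∧ v ∈ S))
    (hDA : ∀ d ∈ D, d ∉ A) (hD : ConnSet G D)
    (hSD : ∀ s ∈ S, ∃ d ∈ D, G.Adj s d) (w₀ : W) (s₀ : V) (hs₀ : s₀ ∈ S) (hs₀f : s₀ ∈ f w₀)
    (hcov : ∀ s ∈ S, ∀ t ∈ S, s ≠ t → ∀ w₁ w₂, s ∈ f w₁ → t ∈ f w₂ → (w₁ = w₂ ∨ P.Adj w₁ w₂) →
      w₁ = w₀ ∨ w₂ = w₀) : HasPet G Set.univ := by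
  have conn' : ∀ w, w ≠ w₀ → ConnSet G (f w) := by
    intro w hw T hT
    refine hf.conn w T ?_
    intro u hu v hv huv
    rcases hGG u v huv with h | ⟨h1, h2⟩
    · exact hT u hu v hv h
    · have := hcov u h1 v h2 huv.ne w w hu hv (Or.inl rfl)
      tauto
  refine ⟨W, P, fun w => {v | v ∈ f w ∨ (w = w₀ ∧ v ∈ D)}, hP, fun w => Set.subset_univ _, ?_, ?_,
    ?_, ?_⟩
  · intro w
    obtain ⟨v, hv⟩ := hf.ne w
    exact ⟨v, Or.inl hv⟩
  · intro w
    by_cases hw : w = w₀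
    · subst hw
      intro T hT
      have hDT : ∀ d ∈ D, ∀ e ∈ D, d ∈ T → e ∈ T := hD T fun u hu v hv huv =>
        hT u (Or.inr ⟨rfl, hu⟩) v (Or.inr ⟨rfl, hv⟩) huv
      have hST : ∀ s ∈ S, s ∈ f w → ∀ d ∈ D, (s ∈ T ↔ d ∈ T) := by
        intro s hs hsf d hd
        obtain ⟨e, he, hse⟩ := hSD s hs
        constructor
        · intro h
          exact hDT e he d hd (hT s (Or.inl hsf) e (Or.inr ⟨rfl, he⟩) hse h)
        · intro h
          exact hT e (Or.inr ⟨rfl, he⟩) s (Or.inl hsf) hse.symm (hDT d hd e he h)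
      have hfT : ∀ u ∈ f w, ∀ v ∈ f w, u ∈ T → v ∈ T := by
        refine hf.conn w T ?_
        intro u hu v hv huv huT
        rcases hGG u v huv with h | ⟨h1, h2⟩
        · exact hT u (Or.inl hu) v (Or.inl hv) h huT
        · obtain ⟨e, he, -⟩ := hSD s₀ hs₀
          exact (hST v h2 hv e he).2 ((hST u h1 hu e he).1 huT)
      rintro u (hu | ⟨-, hu⟩) v (hv | ⟨-, hv⟩) huT
      · exact hfT u hu v hv huT
      · exact (hST s₀ hs₀ hs₀f v hv).1 (hfT u hu s₀ hs₀f huT)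
      · exact hfT s₀ hs₀f v hv ((hST s₀ hs₀ hs₀f u hu).2 huT)
      · exact hDT u hu v hv huT
    · have : {v | v ∈ f w ∨ (w = w₀ ∧ v ∈ D)} = f w := by
        ext v
        simp [hw]
      rw [this]
      exact conn' w hw
  · rintro w₁ w₂ v (h1 | ⟨h1, h1'⟩) (h2 | ⟨h2, h2'⟩)
    · exact hf.disj _ _ _ h1 h2
    · exact absurd (hf.sub _ h1) (hDA v h2')
    · exact absurd (hf.sub _ h2) (hDA v h1')
    · rw [h1, h2]
  · intro w₁ w₂ hw
    obtain ⟨a, ha, b, hb, hab⟩ := hf.adj _ _ hw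
    rcases hGG a b hab with h | ⟨h1, h2⟩
    · exact ⟨a, Or.inl ha, b, Or.inl hb, h⟩
    · rcases hcov a h1 b h2 hab.ne w₁ w₂ ha hb (Or.inr hw) with h | h
      · obtain ⟨d, hd, hbd⟩ := hSD b h2
        exact ⟨d, Or.inr ⟨h, hd⟩, b, Or.inl hb, hbd.symm⟩
      · obtain ⟨d, hd, had⟩ := hSD a h1
        exact ⟨a, Or.inl ha, d, Or.inr ⟨h, hd⟩, had⟩

/-- The case where no triangle edge is used. -/
theorem hasPet_free {V W : Type} {G G' : SimpleGraph V} {S A : Set V} {P : SimpleGraph W}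
    (hP : IsPetersenFamily P) {f : W → Set V} (hf : Model P G' A f)
    (hGG : ∀ u v, G'.Adj u v → G.Adj u v ∨ (u ∈ S ∧ v ∈ S))
    (hcov : ∀ s ∈ S, ∀ t ∈ S, s ≠ t → ∀ w₁ w₂, s ∈ f w₁ → t ∈ f w₂ →
      ¬ (w₁ = w₂ ∨ P.Adj w₁ w₂)) : HasPet G Set.univ := by
  refine ⟨W, P, f, hP, fun w => Set.subset_univ _, hf.ne, ?_, hf.disj, ?_⟩
  · intro w T hT
    refine hf.conn w T ?_
    intro u hu v hv huv
    rcases hGG u v huv with h | ⟨h1, h2⟩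
    · exact hT u hu v hv h
    · exact absurd (Or.inl rfl) (hcov u h1 v h2 huv.ne w w hu hv)
  · intro w₁ w₂ hw
    obtain ⟨a, ha, b, hb, hab⟩ := hf.adj _ _ hw
    rcases hGG a b hab with h | ⟨h1, h2⟩
    · exact ⟨a, ha, b, hb, h⟩
    · exact absurd (Or.inr hw) (hcov a h1 b h2 hab.ne w₁ w₂ ha hb)

/-- The case where the triangle of `G'` realizes a triangle of `P`. -/
theorem hasPet_triangle {V W : Type} {G G' : SimpleGraph V} {x y z : V} {A D : Set V}
    {P : SimpleGraph W} (hP : IsPetersenFamily P) {f : W → Set V} (hf : Model P G' A f)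
    (hGG : ∀ u v, G'.Adj u v → G.Adj u v ∨ ((u = x ∨ u = y ∨ u = z) ∧ (v = x ∨ v = y ∨ v = z)))
    (hDA : ∀ d ∈ D, d ∉ A) (hD : ConnSet G D) (hDne : D.Nonempty)
    (hx : ∃ d ∈ D, G.Adj x d) (hy : ∃ d ∈ D, G.Adj y d) (hz : ∃ d ∈ D, G.Adj z d)
    {a b c : W} (hxa : x ∈ f a) (hyb : y ∈ f b) (hzc : z ∈ f c)
    (hab : P.Adj a b) (hbc : P.Adj b c) (hac : P.Adj a c) : HasPet G Set.univ := by
  have hmem : ∀ w s, s ∈ f w → (s = x ∨ s = y ∨ s = z) →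
      (w = a ∧ s = x) ∨ (w = b ∧ s = y) ∨ (w = c ∧ s = z) := by
    rintro w s hs (rfl | rfl | rfl)
    · exact Or.inl ⟨hf.disj _ _ _ hs hxa, rfl⟩
    · exact Or.inr (Or.inl ⟨hf.disj _ _ _ hs hyb, rfl⟩)
    · exact Or.inr (Or.inr ⟨hf.disj _ _ _ hs hzc, rfl⟩)
  refine ⟨Option W, triangleY P a b c, fun o => o.elim D f, hP.deltaY hab hbc hac,
    fun w => Set.subset_univ _, ?_, ?_, ?_, ?_⟩
  · rintro (_ | w)
    · exact hDne
    · exact hf.ne w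
  · rintro (_ | w)
    · exact hD
    · intro T hT
      refine hf.conn w T ?_
      intro u hu v hv huv
      rcases hGG u v huv with h | ⟨h1, h2⟩
      · exact hT u hu v hv h
      · have h3 := hmem w u hu h1
        have h4 := hmem w v hv h2
        have := huv.ne
        have := hab.ne
        have := hbc.ne
        have := hac.ne
        grind
  · rintro (_ | w₁) (_ | w₂) v h1 h2
    · rfl
    · exact absurd (hf.sub _ h2) (hDA v h1)
    · exact absurd (hf.sub _ h1) (hDA v h2)
    · exact congrArg some (hf.disj _ _ _ h1 h2)
  · have hnone : ∀ w, (w = a ∨ w = b ∨ w = c) → ∃ v ∈ f w, ∃ d ∈ D, G.Adj v d := by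
      rintro w (rfl | rfl | rfl)
      · exact ⟨x, hxa, hx⟩
      · exact ⟨y, hyb, hy⟩
      · exact ⟨z, hzc, hz⟩
    rintro (_ | w₁) (_ | w₂) h
    · exact absurd rfl h.ne
    · rw [triangleY_adj_none] at h
      obtain ⟨v, hv, d, hd, hvd⟩ := hnone w₂ h
      exact ⟨d, hd, v, hv, hvd.symm⟩
    · rw [SimpleGraph.adj_comm, triangleY_adj_none] at h
      exact hnone w₁ h
    · rw [triangleY_adj_some] at h
      obtain ⟨u, hu, v, hv, huv⟩ := hf.adj _ _ h.1
      refine ⟨u, hu, v, hv, (hGG u v huv).resolve_right ?_⟩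
      rintro ⟨h1, h2⟩
      have h3 := hmem _ u hu h1
      have h4 := hmem _ v hv h2
      grind

/-- Replacing a triangle by a connected set attached to all of its vertices preserves having a
minor in the Petersen family. -/
theorem hasPet_replace {V : Type} {G G' : SimpleGraph V} {x y z : V} {A D : Set V}
    (hGG : ∀ u v, G'.Adj u v → G.Adj u v ∨ ((u = x ∨ u = y ∨ u = z) ∧ (v = x ∨ v = y ∨ v = z)))
    (hDA : ∀ d ∈ D, d ∉ A) (hD : ConnSet G D)
    (hx : ∃ d ∈ D, G.Adj x d) (hy : ∃ d ∈ D, G.Adj y d) (hz : ∃ d ∈ D, G.Adj z d)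
    (h : HasPet G' A) : HasPet G Set.univ := by
  obtain ⟨W, P, f, hP, hf⟩ := h
  have hDne : D.Nonempty := by
    obtain ⟨d, hd, -⟩ := hx
    exact ⟨d, hd⟩
  have hGG' : ∀ u v, G'.Adj u v → G.Adj u v ∨
      (u ∈ ({x, y, z} : Set V) ∧ v ∈ ({x, y, z} : Set V)) := by
    simpa using hGG
  have hSD : ∀ s ∈ ({x, y, z} : Set V), ∃ d ∈ D, G.Adj s d := by
    rintro s (rfl | rfl | rfl)
    · exact hx
    · exact hy
    · exact hz
  by_contra hcon
  have cov : ∀ w₀ s₀, s₀ ∈ ({x, y, z} : Set V) → s₀ ∈ f w₀ → ¬ _ := fun w₀ s₀ h1 h2 h3 =>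
    hcon (hasPet_cover hP hf hGG' hDA hD hSD w₀ s₀ h1 h2 h3)
  have free : ¬ _ := fun h3 => hcon (hasPet_free hP hf hGG' h3)
  have tri : ∀ a b c, x ∈ f a → y ∈ f b → z ∈ f c → P.Adj a b → P.Adj b c → ¬ P.Adj a c :=
    fun a b c h1 h2 h3 h4 h5 h6 =>
      hcon (hasPet_triangle hP hf hGG hDA hD hDne hx hy hz h1 h2 h3 h4 h5 h6)
  have hd := hf.disj
  have hsy : ∀ u v, P.Adj u v → P.Adj v u := fun u v h => h.symm
  simp only [Set.mem_insert_iff, Set.mem_singleton_iff] at cov free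
  let E : V → V → Prop := fun s t => ∃ w₁ w₂, s ∈ f w₁ ∧ t ∈ f w₂ ∧ (w₁ = w₂ ∨ P.Adj w₁ w₂)
  have Es : ∀ s t, E s t → E t s := by
    rintro s t ⟨w₁, w₂, h1, h2, h3⟩
    exact ⟨w₂, w₁, h2, h1, h3.imp Eq.symm fun h => h.symm⟩
  -- if the edge opposite to `s₀` is not needed, `s₀` covers
  have step : ∀ s₀, (s₀ = x ∨ s₀ = y ∨ s₀ = z) →
      ¬ ∀ s t, (s = x ∨ s = y ∨ s = z) → (t = x ∨ t = y ∨ t = z) → s ≠ t → s ≠ s₀ → t ≠ s₀ →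
        ¬ E s t := by
    intro s₀ hs₀ hE
    by_cases hex : ∃ w₀, s₀ ∈ f w₀
    · obtain ⟨w₀, hw₀⟩ := hex
      refine cov w₀ s₀ hs₀ hw₀ ?_
      intro s hs t ht hst w₁ w₂ h1 h2 h3
      by_cases hss : s = s₀
      · subst hss
        exact Or.inl (hd _ _ _ h1 hw₀)
      by_cases hts : t = s₀
      · subst hts
        exact Or.inr (hd _ _ _ h2 hw₀)
      exact absurd ⟨w₁, w₂, h1, h2, h3⟩ (hE s t hs ht hst hss hts)
    · refine free ?_
      intro s hs t ht hst w₁ w₂ h1 h2 h3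
      exact hE s t hs ht hst (fun e => hex ⟨w₁, e ▸ h1⟩) (fun e => hex ⟨w₂, e ▸ h2⟩)
        ⟨w₁, w₂, h1, h2, h3⟩
  have Exy : E x y := by
    by_contra hn
    refine step z (by simp) ?_
    rintro s t (rfl | rfl | rfl) (rfl | rfl | rfl) hst h1 h2 hE <;>
      first | exact hst rfl | exact h1 rfl | exact h2 rfl | exact hn hE | exact hn (Es _ _ hE)
  have Eyz : E y z := by
    by_contra hn
    refine step x (by simp) ?_
    rintro s t (rfl | rfl | rfl) (rfl | rfl | rfl) hst h1 h2 hE <;>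
      first | exact hst rfl | exact h1 rfl | exact h2 rfl | exact hn hE | exact hn (Es _ _ hE)
  have Exz : E x z := by
    by_contra hn
    refine step y (by simp) ?_
    rintro s t (rfl | rfl | rfl) (rfl | rfl | rfl) hst h1 h2 hE <;>
      first | exact hst rfl | exact h1 rfl | exact h2 rfl | exact hn hE | exact hn (Es _ _ hE)
  obtain ⟨a, b, hxa, hyb, h1⟩ := Exy
  obtain ⟨b', c, hyb', hzc, h2⟩ := Eyz
  obtain ⟨a', c', hxa', hzc', h3⟩ := Exz
  obtain rfl := hd _ _ _ hxa hxa'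
  obtain rfl := hd _ _ _ hyb hyb'
  obtain rfl := hd _ _ _ hzc hzc'
  have two : ∀ w₀ s₀ t₀ r₀, (∀ s, s = x ∨ s = y ∨ s = z ↔ s = s₀ ∨ s = t₀ ∨ s = r₀) →
      s₀ ∈ f w₀ → t₀ ∈ f w₀ → False := by
    intro w₀ s₀ t₀ r₀ hset hs ht
    refine cov w₀ s₀ ((hset _).2 (by simp)) hs ?_
    intro s hs' t ht' hst w₁ w₂ g1 g2 g3
    rw [hset] at hs' ht'
    rcases hs' with rfl | rfl | rfl
    · exact Or.inl (hd _ _ _ g1 hs)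
    · exact Or.inl (hd _ _ _ g1 ht)
    · rcases ht' with rfl | rfl | rfl
      · exact Or.inr (hd _ _ _ g2 hs)
      · exact Or.inr (hd _ _ _ g2 ht)
      · exact absurd rfl hst
  rcases h1 with rfl | h1
  · exact two a x y z (fun s => Iff.rfl) hxa hyb
  rcases h2 with rfl | h2
  · exact two b y z x (fun s => by tauto) hyb hzc
  rcases h3 with rfl | h3
  · exact two a x z y (fun s => by tauto) hxa hzc
  exact tri a b c hxa hyb hzc h1 h2 h3

/-- In a graph without vertex cuts of size less than three, each vertex of a cut set of size three
has a neighbor in each component. -/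
theorem exists_adj_component {V : Type} {G : SimpleGraph V} {S : Set V} (hG : G.Connected)
    (hS : S.ncard = 3) (hconn3 : ∀ S : Set V, IsVertexCut G S → 3 ≤ S.ncard)
    (D : Set V) (hDne : D.Nonempty) (hDS : ∀ d ∈ D, d ∉ S)
    (hDc : ∀ d ∈ D, ∀ v, v ∉ S → G.Adj d v → v ∈ D) (s : V) (hs : s ∈ S) :
    ∃ d ∈ D, G.Adj s d := by
  by_contra hno
  push Not at hno
  have hfin : S.Finite := Set.finite_of_ncard_ne_zero (by omega)
  have hcut : IsVertexCut G (S \ {s}) := by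
    refine ⟨hG, ?_⟩
    rw [preconnected_iff_connSet]
    intro h
    obtain ⟨d, hd⟩ := hDne
    have := h D ?_ d (fun hh => hDS d hd hh.1) s (fun hh => hh.2 rfl) hd
    · exact hDS s this hs
    · intro u hu v hv huv huD
      by_cases hvS : v ∈ S
      · have : v = s := by
          by_contra hne
          exact hv ⟨hvS, hne⟩
        subst this
        exact absurd huv.symm (hno u huD)
      · exact hDc u huD v hvS huv
  have h1 := hconn3 _ hcut
  have h2 := Set.ncard_sdiff_singleton_add_one hs hfin
  omega

theorem component_connSet {V : Type} {G : SimpleGraph V} {S : Set V}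
    (C : (G.induce Sᶜ).ConnectedComponent) : ConnSet G (Subtype.val '' C.supp) := by
  rintro T hT _ ⟨u, hu, rfl⟩ _ ⟨v, hv, rfl⟩ huT
  rw [SimpleGraph.ConnectedComponent.mem_supp_iff] at hu hv
  obtain ⟨p⟩ := SimpleGraph.ConnectedComponent.exact (hu.trans hv.symm)
  have key : ∀ {a b : (Sᶜ : Set V)} (_ : (G.induce Sᶜ).Walk a b),
      (G.induce Sᶜ).connectedComponentMk a = C → (a : V) ∈ T → (b : V) ∈ T := by
    intro a b p
    induction p with
    | nil => exact fun _ h => h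
    | @cons a b c hab _ ih =>
      intro ha haT
      have hb : (G.induce Sᶜ).connectedComponentMk b = C := by
        rw [← ha]
        exact SimpleGraph.ConnectedComponent.sound hab.symm.reachable
      exact ih hb (hT a ⟨a, ha, rfl⟩ b ⟨b, hb, rfl⟩ hab haT)
  exact key p hu huT

theorem component_closed {V : Type} {G : SimpleGraph V} {S : Set V}
    (C : (G.induce Sᶜ).ConnectedComponent) :
    ∀ d ∈ Subtype.val '' C.supp, ∀ v, v ∉ S → G.Adj d v → v ∈ Subtype.val '' C.supp := by
  rintro _ ⟨u, hu, rfl⟩ v hv huv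
  rw [SimpleGraph.ConnectedComponent.mem_supp_iff] at hu
  refine ⟨⟨v, hv⟩, ?_, rfl⟩
  rw [SimpleGraph.ConnectedComponent.mem_supp_iff, ← hu]
  apply SimpleGraph.ConnectedComponent.sound
  apply SimpleGraph.Adj.reachable
  exact huv.symm

theorem component_nonempty {V : Type} {G : SimpleGraph V} {S : Set V}
    (C : (G.induce Sᶜ).ConnectedComponent) : (Subtype.val '' C.supp).Nonempty :=
  C.nonempty_supp.image _

theorem component_disj {V : Type} {G : SimpleGraph V} {S : Set V}
    (C : (G.induce Sᶜ).ConnectedComponent) : ∀ d ∈ Subtype.val '' C.supp, d ∉ S := by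
  rintro _ ⟨u, _, rfl⟩
  exact u.2

/-- Let `G` be a maxnil graph of vertex connectivity 3 and `S = {x, y, z}` a vertex cut
set of size 3. Then `S` induces a triangle, and for every connected component `C` of
`G - S` the subgraph of `G` induced by `V(C) ∪ S` is maxnil. -/
theorem stmt_8 {V : Type} [Fintype V] (G : SimpleGraph V) (x y z : V)
    (hG : IsMaxnil G) (hxy : x ≠ y) (hxz : x ≠ z) (hyz : y ≠ z)
    (hcut : IsVertexCut G {x, y, z})
    (hconn3 : ∀ S : Set V, IsVertexCut G S → 3 ≤ S.ncard) :
    (G.Adj x y ∧ G.Adj y z ∧ G.Adj x z) ∧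
    ∀ C : (G.induce ({x, y, z} : Set V)ᶜ).ConnectedComponent,
      IsMaxnil (G.induce (Subtype.val '' C.supp ∪ {x, y, z})) := by
  have hS3 : ({x, y, z} : Set V).ncard = 3 := Set.ncard_eq_three.2 ⟨x, y, z, hxy, hxz, hyz, rfl⟩
  have hSe : ({x, y, z} : Set V).encard ≤ 3 := (Set.encard_eq_three.2 ⟨x, y, z, hxy, hxz, hyz, rfl⟩).le
  have hsum : ∀ (H : SimpleGraph V) (C : (G.induce ({x, y, z} : Set V)ᶜ).ConnectedComponent),
      (∀ s ∈ ({x, y, z} : Set V), ∀ t ∈ ({x, y, z} : Set V), s ≠ t → H.Adj s t) →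
      (∀ u ∈ Subtype.val '' C.supp, ∀ v, v ∉ Subtype.val '' C.supp ∪ {x, y, z} → H.Adj u v →
        G.Adj u v) →
      HasPet H Set.univ → HasPet H (Subtype.val '' C.supp ∪ {x, y, z}) ∨
        HasPet H (Subtype.val '' C.supp)ᶜ := by
    intro H C hHS hHG
    refine hasPet_cliqueSum hSe Set.subset_union_right ?_ ?_ ?_ hHS ?_
    · intro s hs hsC
      exact component_disj C s hsC hs
    · intro v
      by_cases hv : v ∈ Subtype.val '' C.supp
      · exact Or.inl (Or.inl hv)
      · exact Or.inr hv
    · rintro v (hv | hv) hv'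
      · exact absurd hv hv'
      · exact hv
    · intro u hu huB v hvB hvA huv
      have huC : u ∈ Subtype.val '' C.supp := not_not.1 huB
      exact hvB (component_closed C u huC v (fun h => hvA (Or.inr h)) (hHG u huC v hvA huv))
  have hGpet : ¬ HasPet G Set.univ := (isLinkless_iff G).1 hG.1
  obtain ⟨hGc, hdis⟩ := hcut
  have hnb : ∀ (C : (G.induce ({x, y, z} : Set V)ᶜ).ConnectedComponent),
      ∀ s ∈ ({x, y, z} : Set V), ∃ d ∈ Subtype.val '' C.supp, G.Adj s d := fun C s hs =>
    exists_adj_component hGc hS3 hconn3 _ (component_nonempty C) (component_disj C)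
      (component_closed C) s hs
  have htri : G.Adj x y ∧ G.Adj y z ∧ G.Adj x z := by
    let G' : SimpleGraph V := G ⊔ SimpleGraph.fromEdgeSet {s(x, y), s(y, z), s(x, z)}
    have hG' : ∀ u v, G'.Adj u v ↔ G.Adj u v ∨
        (u ≠ v ∧ (u = x ∨ u = y ∨ u = z) ∧ (v = x ∨ v = y ∨ v = z)) := by
      intro u v
      simp only [G', SimpleGraph.sup_adj, SimpleGraph.fromEdgeSet_adj, Set.mem_insert_iff,
        Set.mem_singleton_iff, Sym2.eq_iff]
      grind
    have hGG : ∀ u v, G'.Adj u v → G.Adj u v ∨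
        ((u = x ∨ u = y ∨ u = z) ∧ (v = x ∨ v = y ∨ v = z)) := by
      intro u v h
      exact ((hG' u v).1 h).imp id And.right
    obtain ⟨C₁, C₂, hne⟩ : ∃ C₁ C₂ : (G.induce ({x, y, z} : Set V)ᶜ).ConnectedComponent,
        C₁ ≠ C₂ := by
      by_contra hall
      push Not at hall
      exact hdis fun u v => SimpleGraph.ConnectedComponent.exact (hall _ _)
    have hlink : ¬ HasPet G' Set.univ := by
      intro hpet
      have hrep : ∀ (A : Set V) (C : (G.induce ({x, y, z} : Set V)ᶜ).ConnectedComponent),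
          (∀ d ∈ Subtype.val '' C.supp, d ∉ A) → ¬ HasPet G' A := fun A C hCA hA =>
        hGpet (hasPet_replace hGG hCA (component_connSet C) (hnb C x (by simp))
          (hnb C y (by simp)) (hnb C z (by simp)) hA)
      have hor := hsum G' C₁ ?_ ?_ hpet
      rotate_left
      · intro s hs t ht hst
        exact (hG' s t).2 (Or.inr ⟨hst, hs, ht⟩)
      · intro u hu v _ huv
        rcases hGG u v huv with h | h
        · exact h
        · exact absurd h.1 (component_disj C₁ u hu)
      rcases hor with h | h
      · refine hrep _ C₂ ?_ h
        rintro d hd (hd' | hd')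
        · obtain ⟨u, hu, rfl⟩ := hd
          obtain ⟨v, hv, e⟩ := hd'
          rw [Subtype.ext e] at hv
          exact hne (hv.symm.trans hu)
        · exact component_disj C₂ d hd hd'
      · refine hrep _ C₁ ?_ h
        intro d hd hd'
        exact hd' hd
    have hadj : ∀ s t, s ≠ t → (s = x ∨ s = y ∨ s = z) → (t = x ∨ t = y ∨ t = z) →
        G.Adj s t := by
      intro s t hst hs ht
      by_contra hn
      refine hG.2 s t hst hn ((isLinkless_iff _).2 ?_)
      intro hp
      refine hlink (hp.mono subset_rfl ?_)
      intro u _ v _ huv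
      rw [hG']
      simp only [addEdge, SimpleGraph.sup_adj, SimpleGraph.fromEdgeSet_adj, Set.mem_singleton_iff,
        Sym2.eq_iff] at huv
      grind
    exact ⟨hadj x y hxy (by simp) (by simp), hadj y z hyz (by simp) (by simp),
      hadj x z hxz (by simp) (by simp)⟩
  refine ⟨htri, ?_⟩
  have hclique : ∀ s ∈ ({x, y, z} : Set V), ∀ t ∈ ({x, y, z} : Set V), s ≠ t → G.Adj s t := by
    obtain ⟨h1, h2, h3⟩ := htri
    rintro s (rfl | rfl | rfl) t (rfl | rfl | rfl) hst <;>
      first | exact absurd rfl hst | assumption | (apply SimpleGraph.Adj.symm; assumption)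
  intro C
  constructor
  · rw [isLinkless_induce_iff]
    exact fun h => hGpet (h.mono (Set.subset_univ _) fun _ _ _ _ h => h)
  · intro a b hab hnadj
    have heq : addEdge (G.induce (Subtype.val '' C.supp ∪ {x, y, z})) a b =
        (addEdge G a b).induce (Subtype.val '' C.supp ∪ {x, y, z}) := by
      ext u v
      simp only [addEdge, SimpleGraph.sup_adj, SimpleGraph.fromEdgeSet_adj, Set.mem_singleton_iff,
        Sym2.eq_iff, SimpleGraph.induce_adj, Subtype.ext_iff, ne_eq]
    have hadd : ∀ u v, (addEdge G (a : V) b).Adj u v → G.Adj u v ∨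
        (u = a ∧ v = b) ∨ (u = b ∧ v = a) := by
      intro u v huv
      simp only [addEdge, SimpleGraph.sup_adj, SimpleGraph.fromEdgeSet_adj, Set.mem_singleton_iff,
        Sym2.eq_iff] at huv
      tauto
    have hab' : (a : V) ≠ b := fun h => hab (Subtype.ext h)
    have hnadj' : ¬ G.Adj (a : V) b := hnadj
    have hpet := hG.2 a b hab' hnadj'
    rw [isLinkless_iff, not_not] at hpet
    rw [heq, isLinkless_induce_iff, not_not]
    have hor := hsum (addEdge G a b) C ?_ ?_ hpet
    rotate_left
    · intro s hs t ht hst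
      exact Or.inl (hclique s hs t ht hst)
    · intro u _ v hv huv
      rcases hadd u v huv with h | ⟨rfl, rfl⟩ | ⟨rfl, rfl⟩
      · exact h
      · exact absurd b.2 hv
      · exact absurd a.2 hv
    rcases hor with h | h
    · exact h
    · exfalso
      refine hGpet (h.mono (Set.subset_univ _) ?_)
      have hmem : ∀ c : ↑(Subtype.val '' C.supp ∪ ({x, y, z} : Set V)),
          (c : V) ∈ (Subtype.val '' C.supp)ᶜ → (c : V) ∈ ({x, y, z} : Set V) :=
        fun c hc => c.2.resolve_left hc
      intro u hu v hv huv
      rcases hadd u v huv with h | ⟨rfl, rfl⟩ | ⟨rfl, rfl⟩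
      · exact h
      · exact hclique _ (hmem a hu) _ (hmem b hv) hab'
      · exact hclique _ (hmem b hu) _ (hmem a hv) hab'.symm
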